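/- Let a, b > 0 and let Δ be the rectangle with vertices (0,0), (0,a), (b,a), (b,0). Then the toric packing density satisfies ρ_T(Δ) = (min(a,b))² / (ab). -/

import Mathlib

open Matrix MeasureTheory Set

/-- Points of the plane. -/
abbrev Pt := Fin 2 → ℝ

/-- The action of `SL₂(ℤ)` on `ℝ²` by matrix-vector multiplication. -/
noncomputable def sl2Apply (M : Matrix.SpecialLinearGroup (Fin 2) ℤ) (x : Pt) : Pt :=
  ((M : Matrix (Fin 2) (Fin 2) ℤ).map (Int.cast : ℤ → ℝ)).mulVec x

/-- The model triangle `B(λ) = {(x,y) : x ≥ 0, y ≥ 0, x + y < λ}`. -/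
def modelTriangle (lam : ℝ) : Set Pt :=
  {x | 0 ≤ x 0 ∧ 0 ≤ x 1 ∧ x 0 + x 1 < lam}

/-- The area (Lebesgue measure) of a subset of the plane. -/
noncomputable def area (S : Set Pt) : ℝ := (volume S).toReal

/-- `B ⊆ Δ` is an admissibly packed triangle at the point `p` of `SL₂(ℤ)`-size `lam`:
`B = M (B(lam)) + p` for some `M ∈ SL₂(ℤ)` and `B` coincides with `Δ`
in a neighborhood of `p`. -/
def IsPackedTriangle (Δ : Set Pt) (p : Pt) (lam : ℝ) (B : Set Pt) : Prop :=
  0 < lam ∧ B ⊆ Δ ∧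
  (∃ M : Matrix.SpecialLinearGroup (Fin 2) ℤ,
      B = (fun x => sl2Apply M x + p) '' modelTriangle lam) ∧
  ∃ U : Set Pt, IsOpen U ∧ p ∈ U ∧ B ∩ U = Δ ∩ U

/-- `P` is a (toric) packing of the convex polygon with vertices `V`, where the triangle
packed at the vertex `V i` has `SL₂(ℤ)`-size `sz i` (with `sz i = 0` if no triangle is
packed there): `P` is a union of pairwise disjoint admissibly packed triangles. -/
def IsPacking {k : ℕ} (V : Fin k → Pt) (sz : Fin k → ℝ) (P : Set Pt) : Prop :=
  ∃ tri : Fin k → Set Pt,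
    P = (⋃ i, tri i) ∧
    (∀ i, (sz i = 0 ∧ tri i = ∅) ∨
       IsPackedTriangle (convexHull ℝ (Set.range V)) (V i) (sz i) (tri i)) ∧
    Pairwise (Function.onFun Disjoint tri)

/-- The set of densities `area P / area Δ` of packings `P` of the polygon with
vertices `V`; the toric packing density `ρ_T` is its supremum. -/
def densitySet {k : ℕ} (V : Fin k → Pt) : Set ℝ :=
  {r : ℝ | ∃ sz P, IsPacking V sz P ∧ r = area P / area (convexHull ℝ (Set.range V))}

/-- The determinant of a pair of integer vectors in the plane. -/
def detZ (u v : Fin 2 → ℤ) : ℤ := u 0 * v 1 - u 1 * v 0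

/-- `V, dir, len` describe a Delzant polygon with `k` vertices `V i`, listed in clockwise
order: the edge from `V i` to `V (i+1)` is directed along the primitive integer vector
`dir i` and has `SL₂(ℤ)`-length `len i`, and each vertex satisfies the Delzant
condition `det (u₁, u₂) = ± 1`. -/
structure IsDelzantPolygon {k : ℕ} [NeZero k] (V : Fin k → Pt)
    (dir : Fin k → Fin 2 → ℤ) (len : Fin k → ℝ) : Prop where
  three_le : 3 ≤ k
  len_pos : ∀ i, 0 < len i
  primitive : ∀ i, Int.gcd (dir i 0) (dir i 1) = 1
  edge_eq : ∀ i j, V (i + 1) j - V i j = len i * (dir i j : ℝ)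
  clockwise : ∀ i, detZ (dir i) (dir (i + 1)) < 0
  delzant : ∀ i, detZ (dir i) (dir (i + 1)) = 1 ∨ detZ (dir i) (dir (i + 1)) = -1
  edges_boundary : ∀ i, segment ℝ (V i) (V (i + 1)) ⊆ frontier (convexHull ℝ (Set.range V))

/-- The half-open right isosceles triangle of leg `lam` with corner `p`, whose legs point in the
directions `(σ, 0)` and `(0, τ)`. -/
def cornerTriangle (p : Pt) (σ τ : ℤ) (lam : ℝ) : Set Pt :=
  {z | 0 ≤ σ * (z 0 - p 0) ∧ 0 ≤ τ * (z 1 - p 1) ∧ σ * (z 0 - p 0) + τ * (z 1 - p 1) < lam}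

lemma sl2Apply_zero (M : Matrix.SpecialLinearGroup (Fin 2) ℤ) (x : Pt) :
    sl2Apply M x 0 = M 0 0 * x 0 + M 0 1 * x 1 := by
  simp [sl2Apply, Matrix.mulVec, dotProduct, Fin.sum_univ_two]

lemma sl2Apply_one (M : Matrix.SpecialLinearGroup (Fin 2) ℤ) (x : Pt) :
    sl2Apply M x 1 = M 1 0 * x 0 + M 1 1 * x 1 := by
  simp [sl2Apply, Matrix.mulVec, dotProduct, Fin.sum_univ_two]

lemma sl2_det_eq_one (M : Matrix.SpecialLinearGroup (Fin 2) ℤ) :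
    M 0 0 * M 1 1 - M 0 1 * M 1 0 = 1 := by
  rw [← Matrix.det_fin_two, M.det_coe]

/-- The affine image of a model triangle, described by inequalities in the inverse coordinates. -/
lemma mem_image_modelTriangle (M : Matrix.SpecialLinearGroup (Fin 2) ℤ) (p z : Pt) (lam : ℝ) :
    z ∈ (fun x => sl2Apply M x + p) '' modelTriangle lam ↔
      0 ≤ M 1 1 * (z 0 - p 0) - M 0 1 * (z 1 - p 1) ∧
      0 ≤ M 0 0 * (z 1 - p 1) - M 1 0 * (z 0 - p 0) ∧
      (M 1 1 * (z 0 - p 0) - M 0 1 * (z 1 - p 1)) +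
        (M 0 0 * (z 1 - p 1) - M 1 0 * (z 0 - p 0)) < lam := by
  have hdet : (M 0 0 * M 1 1 - M 0 1 * M 1 0 : ℝ) = 1 := mod_cast sl2_det_eq_one M
  constructor
  · rintro ⟨x, ⟨h0, h1, h2⟩, rfl⟩
    simp only [Pi.add_apply, sl2Apply_zero, sl2Apply_one, add_sub_cancel_right]
    have e0 : (M 1 1 * (M 0 0 * x 0 + M 0 1 * x 1) - M 0 1 * (M 1 0 * x 0 + M 1 1 * x 1) : ℝ)
        = x 0 := by linear_combination x 0 * hdet
    have e1 : (M 0 0 * (M 1 0 * x 0 + M 1 1 * x 1) - M 1 0 * (M 0 0 * x 0 + M 0 1 * x 1) : ℝ)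
        = x 1 := by linear_combination x 1 * hdet
    rw [e0, e1]
    exact ⟨h0, h1, h2⟩
  · intro h
    refine ⟨![M 1 1 * (z 0 - p 0) - M 0 1 * (z 1 - p 1),
      M 0 0 * (z 1 - p 1) - M 1 0 * (z 0 - p 0)], by simpa [modelTriangle] using h, ?_⟩
    ext i
    fin_cases i
    · simp only [Fin.zero_eta, Pi.add_apply, sl2Apply_zero, cons_val_zero, cons_val_one]
      linear_combination (z 0 - p 0) * hdet
    · simp only [Fin.mk_one, Pi.add_apply, sl2Apply_one, cons_val_zero, cons_val_one]
      linear_combination (z 1 - p 1) * hdet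

/-- A triangle packed at a corner whose edges point in the directions `(σ, 0)` and `(0, τ)` is the
standard corner triangle. -/
lemma IsPackedTriangle.eq_cornerTriangle {Δ B : Set Pt} {p : Pt} {lam : ℝ} {σ τ : ℤ}
    (hσ : σ = 1 ∨ σ = -1) (hτ : τ = 1 ∨ τ = -1)
    (hΔ : ∀ᶠ z in nhds p, z ∈ Δ ↔ 0 ≤ σ * (z 0 - p 0) ∧ 0 ≤ τ * (z 1 - p 1))
    (h : IsPackedTriangle Δ p lam B) : B = cornerTriangle p σ τ lam := by
  obtain ⟨hlam, -, ⟨M, rfl⟩, U, hU, hpU, hBU⟩ := h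
  have hdet := sl2_det_eq_one M
  have hsmall : ∀ᶠ z in nhds p, (M 1 1 * (z 0 - p 0) - M 0 1 * (z 1 - p 1)) +
        (M 0 0 * (z 1 - p 1) - M 1 0 * (z 0 - p 0)) < lam := by
    have hc : Continuous fun z : Pt => ((M 1 1 * (z 0 - p 0) - M 0 1 * (z 1 - p 1)) +
        (M 0 0 * (z 1 - p 1) - M 1 0 * (z 0 - p 0)) : ℝ) := by fun_prop
    exact hc.continuousAt.eventually_lt continuousAt_const (by simpa using hlam)
  have hcone : ∀ᶠ z in nhds p, (0 ≤ M 1 1 * (z 0 - p 0) - M 0 1 * (z 1 - p 1) ∧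
      0 ≤ M 0 0 * (z 1 - p 1) - M 1 0 * (z 0 - p 0)) ↔
      (0 ≤ σ * (z 0 - p 0) ∧ 0 ≤ τ * (z 1 - p 1)) := by
    filter_upwards [hΔ, hsmall, hU.mem_nhds hpU] with z h1 h2 h3
    have h4 : z ∈ (fun x => sl2Apply M x + p) '' modelTriangle lam ↔ z ∈ Δ := by
      have := Set.ext_iff.1 hBU z
      simpa [h3] using this
    rw [← h1, ← h4, mem_image_modelTriangle]
    tauto
  have hdir : ∀ u v : ℝ, (0 ≤ M 1 1 * u - M 0 1 * v ∧ 0 ≤ M 0 0 * v - M 1 0 * u) ↔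
      (0 ≤ σ * u ∧ 0 ≤ τ * v) := by
    intro u v
    have hc : Continuous fun t : ℝ => (p + t • ![u, v] : Pt) := by fun_prop
    have ht : Filter.Tendsto (fun t : ℝ => (p + t • ![u, v] : Pt)) (nhdsWithin 0 (Ioi 0))
        (nhds p) := by
      have := hc.tendsto 0
      simp only [zero_smul, add_zero] at this
      exact this.mono_left nhdsWithin_le_nhds
    obtain ⟨t, h, ht0⟩ := ((ht.eventually hcone).and self_mem_nhdsWithin).exists
    have ht0 : 0 < t := ht0
    simp only [Pi.add_apply, Pi.smul_apply, cons_val_zero, cons_val_one, smul_eq_mul,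
      add_sub_cancel_left] at h
    have e (k l : ℝ) : k * (t * u) - l * (t * v) = t * (k * u - l * v) := by ring
    have e' (k l : ℝ) : k * (t * v) - l * (t * u) = t * (k * v - l * u) := by ring
    have e'' (k w : ℝ) : k * (t * w) = t * (k * w) := by ring
    rw [e, e', e'', e''] at h
    simpa only [mul_nonneg_iff_of_pos_left ht0] using h
  have hσσ : (0 : ℝ) ≤ σ * σ := mul_self_nonneg _
  have hττ : (0 : ℝ) ≤ τ * τ := mul_self_nonneg _
  have h1 := (hdir σ 0).2 ⟨hσσ, by simp⟩
  have h2 := (hdir 0 τ).2 ⟨by simp, hττ⟩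
  have hdetR : (M 0 0 * M 1 1 - M 0 1 * M 1 0 : ℝ) = 1 := mod_cast hdet
  have h3 := (hdir (M 0 0) (M 1 0)).1 ⟨by linarith, by linarith⟩
  have h4 := (hdir (M 0 1) (M 1 1)).1 ⟨by linarith, by linarith⟩
  simp only [mul_zero, zero_sub, sub_zero] at h1 h2
  norm_cast at h1 h2 h3 h4
  have key : (M 0 1 = 0 ∧ M 1 0 = 0 ∧ M 1 1 = σ ∧ M 0 0 = τ) ∨
      (M 0 0 = 0 ∧ M 1 1 = 0 ∧ M 0 1 = -τ ∧ M 1 0 = -σ) := by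
    generalize M 0 0 = m at *
    generalize M 0 1 = n at *
    generalize M 1 0 = r at *
    generalize M 1 1 = s at *
    rcases hσ with rfl | rfl <;> rcases hτ with rfl | rfl
    · left
      obtain rfl : n = 0 := by omega
      obtain rfl : r = 0 := by omega
      rcases Int.mul_eq_one_iff_eq_one_or_neg_one.1 (show m * s = 1 by linarith) with h | h <;> omega
    · right
      obtain rfl : m = 0 := by omega
      obtain rfl : s = 0 := by omega
      rcases Int.mul_eq_one_iff_eq_one_or_neg_one.1 (show n * (-r) = 1 by linarith) with h | h <;>
        omega
    · right
      obtain rfl : m = 0 := by omega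
      obtain rfl : s = 0 := by omega
      rcases Int.mul_eq_one_iff_eq_one_or_neg_one.1 (show n * (-r) = 1 by linarith) with h | h <;>
        omega
    · left
      obtain rfl : n = 0 := by omega
      obtain rfl : r = 0 := by omega
      rcases Int.mul_eq_one_iff_eq_one_or_neg_one.1 (show m * s = 1 by linarith) with h | h <;> omega
  ext z
  rw [mem_image_modelTriangle]
  simp only [cornerTriangle, mem_ofPred_eq]
  rcases key with ⟨e1, e2, e3, e4⟩ | ⟨e1, e2, e3, e4⟩ <;> simp only [e1, e2, e3, e4]
  · simp
  · simp only [Int.cast_zero, Int.cast_neg, zero_mul, zero_sub, neg_mul, neg_neg]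
    rw [add_comm (τ * (z 1 - p 1) : ℝ)]
    tauto

lemma volume_modelTriangle {lam : ℝ} (hlam : 0 ≤ lam) :
    volume (modelTriangle lam) = ENNReal.ofReal (lam ^ 2 / 2) := by
  have hm : MeasurableSet {q : ℝ × ℝ | 0 ≤ q.1 ∧ 0 ≤ q.2 ∧ q.1 + q.2 < lam} := by
    measurability
  have hpre : modelTriangle lam =
      MeasurableEquiv.finTwoArrow ⁻¹' {q : ℝ × ℝ | 0 ≤ q.1 ∧ 0 ≤ q.2 ∧ q.1 + q.2 < lam} := rfl
  rw [hpre, (volume_preserving_finTwoArrow ℝ).measure_preimage hm.nullMeasurableSet,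
    Measure.volume_eq_prod, Measure.prod_apply hm]
  have hslice : ∀ x : ℝ, volume (Prod.mk x ⁻¹' {q : ℝ × ℝ | 0 ≤ q.1 ∧ 0 ≤ q.2 ∧ q.1 + q.2 < lam}) =
      (Icc 0 lam).indicator (fun x => ENNReal.ofReal (lam - x)) x := by
    intro x
    by_cases hx : x ∈ Icc 0 lam
    · rw [indicator_of_mem hx]
      have : Prod.mk x ⁻¹' {q : ℝ × ℝ | 0 ≤ q.1 ∧ 0 ≤ q.2 ∧ q.1 + q.2 < lam} =
          Ico 0 (lam - x) := by
        ext y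
        simp [hx.1, lt_sub_iff_add_lt']
      rw [this, Real.volume_Ico, sub_zero]
    · rw [indicator_of_notMem hx]
      convert measure_empty (μ := (volume : Measure ℝ))
      ext y
      simp only [mem_preimage, mem_ofPred_eq, mem_empty_iff_false, iff_false]
      rintro ⟨h0, h1, h2⟩
      exact hx ⟨h0, by linarith⟩
  simp_rw [hslice]
  rw [lintegral_indicator measurableSet_Icc,
    ← ofReal_integral_eq_lintegral_ofReal
      (by fun_prop : Continuous fun x : ℝ => lam - x).continuousOn.integrableOn_Icc,
    integral_Icc_eq_integral_Ioc, ← intervalIntegral.integral_of_le hlam]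
  · congr 1
    rw [intervalIntegral.integral_sub (by simp) (by simp)]
    simp
    ring
  · filter_upwards [ae_restrict_mem measurableSet_Icc] with x hx
    simpa using hx.2

lemma measurableSet_cornerTriangle (p : Pt) (σ τ : ℤ) (lam : ℝ) :
    MeasurableSet (cornerTriangle p σ τ lam) := by
  unfold cornerTriangle
  measurability

lemma volume_cornerTriangle (p : Pt) {σ τ : ℤ} (hσ : σ = 1 ∨ σ = -1) (hτ : τ = 1 ∨ τ = -1)
    {lam : ℝ} (hlam : 0 ≤ lam) :
    volume (cornerTriangle p σ τ lam) = ENNReal.ofReal (lam ^ 2 / 2) := by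
  have hσ2 : (σ * σ : ℝ) = 1 := by rcases hσ with rfl | rfl <;> norm_num
  have hτ2 : (τ * τ : ℝ) = 1 := by rcases hτ with rfl | rfl <;> norm_num
  have himage : cornerTriangle p σ τ lam =
      (fun z => z + p) '' (Matrix.toLin' (Matrix.diagonal ![(σ : ℝ), (τ : ℝ)]) ''
        modelTriangle lam) := by
    ext z
    rw [← image_comp]
    constructor
    · intro h
      refine ⟨![σ * (z 0 - p 0), τ * (z 1 - p 1)], by simpa [modelTriangle, cornerTriangle] using h, ?_⟩
      ext i
      fin_cases i
      · simp [← mul_assoc, hσ2]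
      · simp [← mul_assoc, hτ2]
    · rintro ⟨x, hx, rfl⟩
      simp only [cornerTriangle, Function.comp_apply, mem_ofPred_eq, Pi.add_apply,
        Matrix.toLin'_apply, Matrix.mulVec_diagonal, cons_val_zero, cons_val_one,
        add_sub_cancel_right, ← mul_assoc, hσ2, hτ2, one_mul]
      exact hx
  have hdet : |(σ * τ : ℝ)| = 1 := by
    rcases hσ with rfl | rfl <;> rcases hτ with rfl | rfl <;> norm_num
  rw [himage, image_add_right, measure_preimage_add_right, Measure.addHaar_image_linearMap,
    LinearMap.det_toLin', Matrix.det_diagonal, Fin.prod_univ_two, volume_modelTriangle hlam]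
  simp [hdet]

lemma convexHull_rectangle {a b : ℝ} (ha : 0 < a) (hb : 0 < b) :
    convexHull ℝ (range (![![0, 0], ![0, a], ![b, a], ![b, 0]] : Fin 4 → Pt)) =
      Icc 0 ![b, a] := by
  apply Subset.antisymm
  · refine convexHull_min ?_ (convex_Icc _ _)
    rintro _ ⟨i, rfl⟩
    simp only [mem_Icc, Pi.le_def, Fin.forall_fin_two]
    fin_cases i <;> simp [ha.le, hb.le]
  · intro z hz
    simp only [mem_Icc, Pi.le_def, Fin.forall_fin_two, Pi.zero_apply, cons_val_zero,
      cons_val_one] at hz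
    obtain ⟨⟨h0, h1⟩, h2, h3⟩ := hz
    set V : Fin 4 → Pt := ![![0, 0], ![0, a], ![b, a], ![b, 0]] with hV
    have hmem (i : Fin 4) : V i ∈ convexHull ℝ (range V) := subset_convexHull _ _ ⟨i, rfl⟩
    have hc := convex_convexHull ℝ (range V)
    have hs0 : 0 ≤ z 0 / b := by positivity
    have hs1 : 0 ≤ 1 - z 0 / b := by rw [sub_nonneg, div_le_one hb]; exact h2
    have ht0 : 0 ≤ z 1 / a := by positivity
    have ht1 : 0 ≤ 1 - z 1 / a := by rw [sub_nonneg, div_le_one ha]; exact h3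
    have hl := hc (hmem 0) (hmem 1) ht1 ht0 (by ring)
    have hr := hc (hmem 3) (hmem 2) ht1 ht0 (by ring)
    convert hc hl hr hs1 hs0 (by ring) using 1
    ext i
    fin_cases i
    · simp [hV]
      field_simp
      ring
    · simp [hV]
      field_simp
      ring

lemma area_rectangle {a b : ℝ} (ha : 0 < a) (hb : 0 < b) :
    area (Icc 0 ![b, a]) = a * b := by
  rw [area, Real.volume_Icc_pi, Fin.prod_univ_two]
  simp [ha.le, hb.le, mul_comm]

/-- Horizontal inward directions at the vertices of the rectangle. -/
def horizontalSign : Fin 4 → ℤ := ![1, 1, -1, -1]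

/-- Vertical inward directions at the vertices of the rectangle. -/
def verticalSign : Fin 4 → ℤ := ![1, -1, -1, 1]

lemma horizontalSign_eq (i : Fin 4) : horizontalSign i = 1 ∨ horizontalSign i = -1 := by
  fin_cases i <;> simp [horizontalSign]

lemma verticalSign_eq (i : Fin 4) : verticalSign i = 1 ∨ verticalSign i = -1 := by
  fin_cases i <;> simp [verticalSign]

/-- Near each vertex the rectangle is a quadrant. -/
lemma eventually_mem_rectangle_iff {a b : ℝ} (ha : 0 < a) (hb : 0 < b) (i : Fin 4) :
    ∀ᶠ z in nhds ((![![0, 0], ![0, a], ![b, a], ![b, 0]] : Fin 4 → Pt) i),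
      z ∈ Icc (0 : Pt) ![b, a] ↔
        0 ≤ horizontalSign i *
          (z 0 - (![![0, 0], ![0, a], ![b, a], ![b, 0]] : Fin 4 → Pt) i 0) ∧
        0 ≤ verticalSign i *
          (z 1 - (![![0, 0], ![0, a], ![b, a], ![b, 0]] : Fin 4 → Pt) i 1) := by
  set p := (![![0, 0], ![0, a], ![b, a], ![b, 0]] : Fin 4 → Pt) i with hp
  have h0 : ∀ᶠ z in nhds p, z 0 ∈ Ioo (p 0 - b) (p 0 + b) :=
    (continuous_apply 0).continuousAt.eventually (Ioo_mem_nhds (by linarith) (by linarith))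
  have h1 : ∀ᶠ z in nhds p, z 1 ∈ Ioo (p 1 - a) (p 1 + a) :=
    (continuous_apply 1).continuousAt.eventually (Ioo_mem_nhds (by linarith) (by linarith))
  filter_upwards [h0, h1] with z h0 h1
  simp only [mem_Icc, Pi.le_def, Fin.forall_fin_two, Pi.zero_apply, cons_val_zero, cons_val_one]
  fin_cases i <;> simp [hp, horizontalSign, verticalSign] at h0 h1 ⊢ <;> grind

/-- In a packing of the rectangle every triangle is a corner triangle. -/
lemma IsPacking.exists_cornerTriangle {a b : ℝ} (ha : 0 < a) (hb : 0 < b) {sz : Fin 4 → ℝ}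
    {P : Set Pt} (h : IsPacking ![![0, 0], ![0, a], ![b, a], ![b, 0]] sz P) :
    ∃ tri : Fin 4 → Set Pt, P = (⋃ i, tri i) ∧ Pairwise (Function.onFun Disjoint tri) ∧
      ∀ i, 0 ≤ sz i ∧ tri i ⊆ Icc 0 ![b, a] ∧
        tri i = cornerTriangle ((![![0, 0], ![0, a], ![b, a], ![b, 0]] : Fin 4 → Pt) i)
          (horizontalSign i) (verticalSign i) (sz i) := by
  obtain ⟨tri, hP, htri, hdisj⟩ := h
  rw [convexHull_rectangle ha hb] at htri
  refine ⟨tri, hP, hdisj, fun i => ?_⟩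
  rcases htri i with ⟨h0, h1⟩ | h
  · refine ⟨h0.ge, by simp [h1], ?_⟩
    rw [h1, h0, eq_comm, eq_empty_iff_forall_notMem]
    rintro z ⟨h2, h3, h4⟩
    linarith
  · exact ⟨h.1.le, h.2.1, h.eq_cornerTriangle (horizontalSign_eq i) (verticalSign_eq i)
      (eventually_mem_rectangle_iff ha hb i)⟩

/-- The area of a packing of the rectangle is half the sum of the squares of the sizes. -/
lemma IsPacking.area_eq {a b : ℝ} (ha : 0 < a) (hb : 0 < b) {sz : Fin 4 → ℝ}
    {P : Set Pt} (h : IsPacking ![![0, 0], ![0, a], ![b, a], ![b, 0]] sz P) :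
    area P = ∑ i, sz i ^ 2 / 2 := by
  obtain ⟨tri, rfl, hdisj, htri⟩ := h.exists_cornerTriangle ha hb
  have hm (i : Fin 4) : MeasurableSet (tri i) := by
    rw [(htri i).2.2]
    exact measurableSet_cornerTriangle _ _ _ _
  have hv (i : Fin 4) : volume (tri i) = ENNReal.ofReal (sz i ^ 2 / 2) := by
    rw [(htri i).2.2, volume_cornerTriangle _ (horizontalSign_eq i) (verticalSign_eq i) (htri i).1]
  rw [area, measure_iUnion hdisj hm, tsum_fintype, ENNReal.toReal_sum (by simp [hv])]
  refine Finset.sum_congr rfl fun i _ => ?_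
  rw [hv, ENNReal.toReal_ofReal (by positivity)]

/-- Two half-open initial segments from the opposite ends of a segment of length `c` that do not
meet have total length at most `c`. -/
lemma add_le_of_disjoint_ends {x y c : ℝ} (hc : 0 < c)
    (hx : ∀ t, 0 ≤ t → t < x → t ≤ c) (hy : ∀ t, 0 ≤ t → t < y → t ≤ c)
    (hxy : ∀ t, 0 ≤ t → t < x → 0 ≤ c - t → c - t < y → False) : x + y ≤ c := by
  by_contra! h
  have hxc : x ≤ c := by
    by_contra! hlt
    linarith [hx ((c + x) / 2) (by linarith) (by linarith)]
  have hyc : y ≤ c := by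
    by_contra! hlt
    linarith [hy ((c + y) / 2) (by linarith) (by linarith)]
  exact hxy ((x + (c - y)) / 2) (by linarith) (by linarith) (by linarith) (by linarith)

/-- The sizes in a packing of the rectangle satisfy the edge inequalities. -/
lemma IsPacking.edge_le {a b : ℝ} (ha : 0 < a) (hb : 0 < b) {sz : Fin 4 → ℝ}
    {P : Set Pt} (h : IsPacking ![![0, 0], ![0, a], ![b, a], ![b, 0]] sz P) :
    sz 0 + sz 1 ≤ a ∧ sz 1 + sz 2 ≤ b ∧ sz 3 + sz 2 ≤ a ∧ sz 0 + sz 3 ≤ b := by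
  obtain ⟨tri, -, hdisj, htri⟩ := h.exists_cornerTriangle ha hb
  have hsub (i : Fin 4) (z : Pt) (hz : z ∈ tri i) : z 0 ≤ b ∧ z 1 ≤ a ∧ 0 ≤ z 0 ∧ 0 ≤ z 1 := by
    have := (htri i).2.1 hz
    simp only [mem_Icc, Pi.le_def, Fin.forall_fin_two, Pi.zero_apply, cons_val_zero,
      cons_val_one] at this
    tauto
  have hne (i j : Fin 4) (hij : i ≠ j) (z : Pt) (hi : z ∈ tri i) (hj : z ∈ tri j) : False :=
    Set.disjoint_left.1 (hdisj hij) hi hj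
  have h0 (x y : ℝ) (hx : 0 ≤ x) (hy : 0 ≤ y) (hxy : x + y < sz 0) : ![x, y] ∈ tri 0 := by
    rw [(htri 0).2.2]
    simp [cornerTriangle, horizontalSign, verticalSign, hx, hy, hxy]
  have h1 (x y : ℝ) (hx : 0 ≤ x) (hy : 0 ≤ a - y) (hxy : x + (a - y) < sz 1) :
      ![x, y] ∈ tri 1 := by
    rw [(htri 1).2.2]
    simpa [cornerTriangle, horizontalSign, verticalSign, hx] using ⟨by linarith, by linarith⟩
  have h2 (x y : ℝ) (hx : 0 ≤ b - x) (hy : 0 ≤ a - y) (hxy : b - x + (a - y) < sz 2) :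
      ![x, y] ∈ tri 2 := by
    rw [(htri 2).2.2]
    simpa [cornerTriangle, horizontalSign, verticalSign] using
      ⟨by linarith, by linarith, by linarith⟩
  have h3 (x y : ℝ) (hx : 0 ≤ b - x) (hy : 0 ≤ y) (hxy : b - x + y < sz 3) :
      ![x, y] ∈ tri 3 := by
    rw [(htri 3).2.2]
    simpa [cornerTriangle, horizontalSign, verticalSign] using
      ⟨by linarith, by linarith, by linarith⟩
  refine ⟨?_, ?_, ?_, ?_⟩
  · refine add_le_of_disjoint_ends ha (fun t ht htx => ?_)
      (fun t ht htx => ?_) (fun t ht htx ht' hty => ?_)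
    · simpa using (hsub 0 _ (h0 0 t le_rfl ht (by linarith))).2.1
    · simpa using (hsub 1 _ (h1 0 (a - t) le_rfl (by linarith) (by linarith))).2.2.2
    · exact hne 0 1 (by decide) _ (h0 0 t le_rfl ht (by linarith))
        (h1 0 t le_rfl (by linarith) (by linarith))
  · refine add_le_of_disjoint_ends hb (fun t ht htx => ?_)
      (fun t ht htx => ?_) (fun t ht htx ht' hty => ?_)
    · simpa using (hsub 1 _ (h1 t a ht (by linarith) (by linarith))).1
    · simpa using (hsub 2 _ (h2 (b - t) a (by linarith) (by linarith) (by linarith))).2.2.1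
    · exact hne 1 2 (by decide) _ (h1 t a ht (by linarith) (by linarith))
        (h2 t a (by linarith) (by linarith) (by linarith))
  · refine add_le_of_disjoint_ends ha (fun t ht htx => ?_)
      (fun t ht htx => ?_) (fun t ht htx ht' hty => ?_)
    · simpa using (hsub 3 _ (h3 b t (by linarith) ht (by linarith))).2.1
    · simpa using (hsub 2 _ (h2 b (a - t) (by linarith) (by linarith) (by linarith))).2.2.2
    · exact hne 3 2 (by decide) _ (h3 b t (by linarith) ht (by linarith))
        (h2 b t (by linarith) (by linarith) (by linarith))
  · refine add_le_of_disjoint_ends hb (fun t ht htx => ?_)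
      (fun t ht htx => ?_) (fun t ht htx ht' hty => ?_)
    · simpa using (hsub 0 _ (h0 t 0 ht le_rfl (by linarith))).1
    · simpa using (hsub 3 _ (h3 (b - t) 0 (by linarith) le_rfl (by linarith))).2.2.1
    · exact hne 0 3 (by decide) _ (h0 t 0 ht le_rfl (by linarith))
        (h3 t 0 (by linarith) le_rfl (by linarith))

/-- Two triangles of size `min a b` at opposite vertices pack the rectangle. -/
lemma isPacking_opposite_corners {a b : ℝ} (ha : 0 < a) (hb : 0 < b) :
    ∃ P, IsPacking ![![0, 0], ![0, a], ![b, a], ![b, 0]] ![min a b, 0, min a b, 0] P := by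
  have hm : 0 < min a b := lt_min ha hb
  have hma := min_le_left a b
  have hmb := min_le_right a b
  have hsum : min a b + min a b ≤ a + b := add_le_add hma hmb
  refine ⟨_, ![{z | 0 ≤ z 0 ∧ 0 ≤ z 1 ∧ z 0 + z 1 < min a b}, ∅,
    {z | z 0 ≤ b ∧ z 1 ≤ a ∧ a + b - min a b < z 0 + z 1}, ∅], rfl, ?_, ?_⟩
  · rw [convexHull_rectangle ha hb]
    generalize min a b = m at *
    intro i
    fin_cases i
    · right
      refine ⟨hm, ?_, ⟨1, ?_⟩, {z | z 0 + z 1 < m}, ?_, ?_, ?_⟩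
      · rintro z ⟨h0, h1, h2⟩
        simp [Pi.le_def, Fin.forall_fin_two]
        refine ⟨⟨h0, h1⟩, ?_, ?_⟩ <;> linarith
      · ext z
        rw [mem_image_modelTriangle]
        simp
      · exact isOpen_lt (by fun_prop) (by fun_prop)
      · simpa using hm
      · ext z
        simp [Pi.le_def, Fin.forall_fin_two]
        intro h
        constructor
        · rintro ⟨h0, h1, h2⟩
          refine ⟨⟨h0, h1⟩, ?_, ?_⟩ <;> linarith
        · rintro ⟨⟨h0, h1⟩, -⟩
          exact ⟨h0, h1, h⟩
    · left; simp
    · right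
      refine ⟨hm, ?_, ⟨-1, ?_⟩, {z | a + b - m < z 0 + z 1}, ?_, ?_, ?_⟩
      · rintro z ⟨h0, h1, h2⟩
        simp [Pi.le_def, Fin.forall_fin_two]
        refine ⟨⟨?_, ?_⟩, ?_, ?_⟩ <;> linarith
      · ext z
        rw [mem_image_modelTriangle]
        simp
        intro h0 h1
        constructor <;> intro h <;> linarith
      · exact isOpen_lt (by fun_prop) (by fun_prop)
      · simp
        linarith
      · ext z
        simp [Pi.le_def, Fin.forall_fin_two]
        intro h
        constructor
        · rintro ⟨h0, h1, h2⟩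
          refine ⟨⟨?_, ?_⟩, ?_, ?_⟩ <;> linarith
        · rintro ⟨-, h0, h1⟩
          exact ⟨h0, h1, h⟩
    · left; simp
  · have hd : Disjoint {z : Pt | 0 ≤ z 0 ∧ 0 ≤ z 1 ∧ z 0 + z 1 < min a b}
        {z | z 0 ≤ b ∧ z 1 ≤ a ∧ a + b - min a b < z 0 + z 1} := by
      rw [Set.disjoint_left]
      rintro z ⟨-, -, h1⟩ ⟨-, -, h2⟩
      linarith
    intro i j hij
    fin_cases i <;> fin_cases j <;> simp [Function.onFun, hd, hd.symm, -lt_inf_iff] at hij ⊢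

/-- The rectangle with vertices `(0,0)`, `(0,a)`, `(b,a)`, `(b,0)` has
toric packing density `ρ_T(Δ) = (min a b)² / (a b)`. -/
theorem stmt7 (a b : ℝ) (ha : 0 < a) (hb : 0 < b) :
    IsLUB (densitySet (![![0, 0], ![0, a], ![b, a], ![b, 0]] : Fin 4 → Pt))
      ((min a b) ^ 2 / (a * b)) := by
  constructor
  · rintro _ ⟨sz, P, hP, rfl⟩
    rw [convexHull_rectangle ha hb, area_rectangle ha hb, hP.area_eq ha hb, Fin.sum_univ_four]
    obtain ⟨tri, -, -, htri⟩ := hP.exists_cornerTriangle ha hb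
    obtain ⟨h01, h12, h32, h03⟩ := hP.edge_le ha hb
    have h (i : Fin 4) : 0 ≤ sz i := (htri i).1
    have hpair {x y c : ℝ} (hx : 0 ≤ x) (hy : 0 ≤ y) (hxy : x + y ≤ c) :
        x ^ 2 + y ^ 2 ≤ c ^ 2 := by
      nlinarith [mul_nonneg hx hy]
    gcongr
    rcases le_total a b with hab | hab
    · rw [min_eq_left hab]
      linarith [hpair (h 0) (h 1) h01, hpair (h 3) (h 2) h32]
    · rw [min_eq_right hab]
      linarith [hpair (h 1) (h 2) h12, hpair (h 0) (h 3) h03]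
  · intro r hr
    obtain ⟨P, hP⟩ := isPacking_opposite_corners ha hb
    refine hr ⟨_, P, hP, ?_⟩
    rw [convexHull_rectangle ha hb, area_rectangle ha hb, hP.area_eq ha hb, Fin.sum_univ_four]
    simp
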